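/- Let ℓ ≥ 4 and let H be a 3-uniform hypergraph of diameter at most ℓ. If H contains a pseudocycle of length m for some m ≥ 3 with m not divisible by 3, then H contains a pseudocycle of length m' for some m' ≤ 4ℓ with m' not divisible by 3. -/

import Mathlib

/-- `H` has a pseudocycle of length `ℓ`: a sequence of vertices indexed by `ZMod ℓ`
such that every three cyclically consecutive vertices form an edge of `H`. -/
def HasPseudocycle {V : Type} [DecidableEq V] (H : Finset (Finset V)) (ℓ : ℕ) : Prop :=
  ∃ v : ZMod ℓ → V, ∀ i : ZMod ℓ, ({v i, v (i + 1), v (i + 2)} : Finset V) ∈ H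
/-- `v` (restricted to indices `0, …, m − 1`) is a pseudopath of order `m` in `H` from the
ordered pair `(x, y)` to the ordered pair `(z, w)`. -/
def IsPseudopathFrom {V : Type} [DecidableEq V] (H : Finset (Finset V)) (m : ℕ)
    (v : ℕ → V) (x y z w : V) : Prop :=
  (∀ i : ℕ, i + 3 ≤ m → ({v i, v (i + 1), v (i + 2)} : Finset V) ∈ H) ∧
  v 0 = x ∧ v 1 = y ∧ v (m - 2) = z ∧ v (m - 1) = w

/-- `H` has diameter at most `ℓ`: whenever there is a pseudopath from `(x, y)` to `(z, w)`
(with `x ≠ y`, `z ≠ w`), there is one of order at most `ℓ`. -/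
def DiamAtMost {V : Type} [DecidableEq V] (H : Finset (Finset V)) (ℓ : ℕ) : Prop :=
  ∀ x y z w : V, x ≠ y → z ≠ w →
    (∃ m : ℕ, ∃ v : ℕ → V, 2 ≤ m ∧ IsPseudopathFrom H m v x y z w) →
    (∃ m : ℕ, ∃ v : ℕ → V, 2 ≤ m ∧ m ≤ ℓ ∧ IsPseudopathFrom H m v x y z w)

/-- walk of `k` steps on ordered pairs -/
def PWalk {V : Type} [DecidableEq V] (H : Finset (Finset V)) (k : ℕ) (x y z w : V) : Prop :=
  ∃ v : ℕ → V, (∀ i, i < k → ({v i, v (i + 1), v (i + 2)} : Finset V) ∈ H) ∧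
    v 0 = x ∧ v 1 = y ∧ v k = z ∧ v (k + 1) = w

theorem PWalk.trans {V : Type} [DecidableEq V] {H : Finset (Finset V)} {k l : ℕ}
    {x y z w a b : V} (h1 : PWalk H k x y z w) (h2 : PWalk H l z w a b) :
    PWalk H (k + l) x y a b := by
  obtain ⟨v, hv, v0, v1, vk, vk1⟩ := h1
  obtain ⟨u, hu, u0, u1, uk, uk1⟩ := h2
  let t : ℕ → V := fun i => if i < k then v i else u (i - k)
  have tv : ∀ i, i ≤ k + 1 → t i = v i := by
    intro i hi
    by_cases h : i < k
    · simp [t, h]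
    · obtain rfl | rfl : i = k ∨ i = k + 1 := by omega
      · simp [t, u0, vk]
      · simp [t, u1, vk1]
  have tu : ∀ j, t (k + j) = u j := by
    intro j
    simp [t]
  refine ⟨t, ?_, ?_, ?_, ?_, ?_⟩
  · intro i hi
    by_cases h : i < k
    · rw [tv i (by omega), tv (i + 1) (by omega), tv (i + 2) (by omega)]
      exact hv i h
    · obtain ⟨j, rfl⟩ : ∃ j, i = k + j := ⟨i - k, by omega⟩
      rw [add_assoc, add_assoc, tu, tu, tu]
      exact hu j (by omega)
  · rw [tv 0 (by omega), v0]
  · rw [tv 1 (by omega), v1]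
  · rw [tu, uk]
  · rw [add_assoc, tu, uk1]

theorem PWalk.cycle {V : Type} [DecidableEq V] {H : Finset (Finset V)} {k : ℕ}
    {x y : V} (hk : 3 ≤ k) (h : PWalk H k x y x y) : HasPseudocycle H k := by
  obtain ⟨v, hv, v0, v1, vk, vk1⟩ := h
  have : NeZero k := ⟨by omega⟩
  have key : ∀ j, j ≤ k + 1 → v (j % k) = v j := by
    intro j hj
    by_cases h : j < k
    · rw [Nat.mod_eq_of_lt h]
    · obtain rfl | rfl : j = k ∨ j = k + 1 := by omega
      · rw [Nat.mod_self, v0, vk]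
      · rw [Nat.add_mod_left, Nat.mod_eq_of_lt (by omega), v1, vk1]
  refine ⟨fun i => v i.val, fun i => ?_⟩
  have hi := ZMod.val_lt i
  have e : ∀ j : ℕ, (i + (j : ZMod k)).val = (i.val + j) % k := by
    intro j
    rw [ZMod.val_add, ZMod.val_natCast, Nat.add_mod_mod]
  have e1 := e 1
  have e2 := e 2
  push_cast at e1 e2
  simp only [e1, e2]
  rw [key _ (by omega), key _ (by omega)]
  exact hv _ hi

/-- If a 3-uniform hypergraph of diameter at most `ℓ ≥ 4` has a pseudocycle of length not
divisible by `3`, then it has one of length at most `4ℓ` not divisible by `3`. -/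
theorem short_odd_pseudocycle_of_diam (n : ℕ) (H : Finset (Finset (Fin n)))
    (h3 : ∀ e ∈ H, e.card = 3) (ℓ : ℕ) (hℓ : 4 ≤ ℓ) (hdiam : DiamAtMost H ℓ)
    (m : ℕ) (hm : 3 ≤ m) (hm3 : ¬ (3 ∣ m)) (hcyc : HasPseudocycle H m) :
    ∃ m' : ℕ, 3 ≤ m' ∧ m' ≤ 4 * ℓ ∧ ¬ (3 ∣ m') ∧ HasPseudocycle H m' := by
  by_contra hcon
  push Not at hcon
  obtain ⟨c, hc⟩ := hcyc
  let u : ℕ → Fin n := fun i => c (i : ZMod m)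
  have hu : ∀ i, ({u i, u (i + 1), u (i + 2)} : Finset (Fin n)) ∈ H := by
    intro i
    have := hc (i : ZMod m)
    simpa [u] using this
  have hper : ∀ i j, u (i + j * m) = u i := by
    intro i j
    simp [u]
  have hne : ∀ i, u i ≠ u (i + 1) := by
    intro i h
    have h1 := h3 _ (hu i)
    rw [h] at h1
    have h2 : ({u (i + 1), u (i + 1), u (i + 2)} : Finset (Fin n)).card ≤ 2 := by
      simpa using Finset.card_le_two (a := u (i + 1)) (b := u (i + 2))
    omega
  have hwalk : ∀ i k, PWalk H k (u i) (u (i + 1)) (u (i + k)) (u (i + k + 1)) := fun i k =>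
    ⟨fun j => u (i + j), fun j _ => hu (i + j), rfl, rfl, rfl, rfl⟩
  have hshort : ∀ i j k, PWalk H k (u i) (u (i + 1)) (u j) (u (j + 1)) →
      ∃ d, d + 2 ≤ ℓ ∧ PWalk H d (u i) (u (i + 1)) (u j) (u (j + 1)) := by
    rintro i j k ⟨v, hv, a0, a1, a2, a3⟩
    obtain ⟨q, w, hq2, hql, hw, b0, b1, b2, b3⟩ := hdiam _ _ _ _ (hne i) (hne j)
      ⟨k + 2, v, by omega, fun t ht => hv t (by omega), a0, a1, a2, a3⟩
    obtain ⟨d, rfl⟩ : ∃ d, q = d + 2 := ⟨q - 2, by omega⟩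
    exact ⟨d, hql, w, fun t ht => hw t (by omega), b0, b1, b2, b3⟩
  have hclosed : ∀ k x y, x ≠ y → k ≤ 4 * ℓ → PWalk H k x y x y → 3 ∣ k := by
    intro k x y hxy hk hw
    by_contra h
    by_cases hk3 : 3 ≤ k
    · exact hcon k hk3 hk h (hw.cycle hk3)
    · obtain ⟨v, hv, v0, v1, vk, vk1⟩ := hw
      obtain rfl | rfl : k = 1 ∨ k = 2 := by omega
      · exact hxy (by rw [← vk, v1])
      · have h1 := h3 _ (hv 0 (by omega))
        simp only [zero_add] at h1
        rw [vk, v0, v1] at h1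
        have h2 : ({x, y, x} : Finset (Fin n)).card ≤ 2 := by
          have : ({x, y, x} : Finset (Fin n)) = {x, y} := by ext; simp; tauto
          rw [this]; exact Finset.card_le_two
        omega
  have hd : ∀ i, ∃ d, d + 2 ≤ ℓ ∧ PWalk H d (u 0) (u 1) (u i) (u (i + 1)) := by
    intro i
    have := hwalk 0 i
    simp only [zero_add] at this
    exact hshort 0 i i this
  have hr : ∀ i, ∃ d, d + 2 ≤ ℓ ∧ PWalk H d (u i) (u (i + 1)) (u 0) (u 1) := by
    intro i
    have := hwalk i (i * (m - 1))
    have e : i + i * (m - 1) = 0 + i * m := by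
      obtain ⟨t, rfl⟩ : ∃ t, m = t + 1 := ⟨m - 1, by omega⟩
      simp; ring
    have e' : i + i * (m - 1) + 1 = 1 + i * m := by omega
    rw [e', e, hper, hper] at this
    exact hshort i 0 _ this
  choose d hdl hdw using hd
  choose r hrl hrw using hr
  have A : ∀ i, 3 ∣ d i + r i := fun i =>
    hclosed _ _ _ (hne 0) (by have := hdl i; have := hrl i; omega) ((hdw i).trans (hrw i))
  have B : ∀ i, 3 ∣ d i + 1 + r (i + 1) := fun i =>
    hclosed _ _ _ (hne 0) (by have := hdl i; have := hrl (i + 1); omega)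
      (((hdw i).trans (hwalk i 1)).trans (hrw (i + 1)))
  have C : 3 ∣ d m + r 0 := by
    have hw := hdw m
    have e0 := hper 0 1
    have e1 := hper 1 1
    rw [show 0 + 1 * m = m by omega] at e0
    rw [show 1 + 1 * m = m + 1 by omega] at e1
    rw [e0, e1] at hw
    exact hclosed _ _ _ (hne 0) (by have := hdl m; have := hrl 0; omega) (hw.trans (hrw 0))
  have D : ∀ i, d i % 3 = (d 0 + i) % 3 := by
    intro i
    induction i with
    | zero => rfl
    | succ i ih =>
      have := A (i + 1)
      have := B i
      omega
  have := D m
  have := A 0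
  omega
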